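/- arXiv:1606.00738 — 2 statements merged into one kernel-verified Lean document; each statement's English description precedes it below -/
import Mathlib

section
/- Let V ⊂ ℝ^d be a convex, centrally symmetric set with standard Gaussian measure γ_d(V) ≥ 2^{−d/7}, and let u₁, …, u_d be vectors in the Euclidean unit ball of ℝ^d. Then there exists ε ∈ {−1, 0, 1}^d with ||ε||₁ ≥ d/2 such that Σ_{i=1}^d ε_i u_i ∈ 4V. -/
open MeasureTheory ProbabilityTheory Finset Pointwise

/-- The standard Gaussian measure on `ℝ^d`. -/
noncomputable def stdGaussian (d : ℕ) : Measure (Fin d → ℝ) :=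
  Measure.pi fun _ => gaussianReal 0 1

/-! ### Diameter of subsets of the discrete cube -/

/-- The section of a subset of the cube over a value of the first coordinate. -/
def cubeSection {n : ℕ} (A : Finset (Fin (n + 1) → Bool)) (b : Bool) : Finset (Fin n → Bool) :=
  {x | (Fin.cons b x : Fin (n + 1) → Bool) ∈ A}

lemma card_eq_card_cubeSection_add {n : ℕ} (A : Finset (Fin (n + 1) → Bool)) :
    #A = #(cubeSection A true) + #(cubeSection A false) := by
  have h : #A = ∑ x : Fin (n + 1) → Bool, if x ∈ A then 1 else 0 := by simp
  rw [h, ← (Fin.consEquiv fun _ : Fin (n + 1) => Bool).sum_comp, Fintype.sum_prod_type]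
  simp only [Fintype.sum_bool, cubeSection, card_filter]
  rfl

lemma hammingDist_cons {n : ℕ} (a b : Bool) (x y : Fin n → Bool) :
    hammingDist (Fin.cons a x : Fin (n + 1) → Bool) (Fin.cons b y) =
      (if a = b then 0 else 1) + hammingDist x y := by
  simp only [hammingDist, card_filter, Fin.sum_univ_succ, Fin.cons_zero, Fin.cons_succ, ne_eq,
    ite_not]

/-- Exponential form of Kleitman's isodiametric inequality, for pairs of subsets of the cube. -/
lemma card_mul_card_le_of_hammingDist_le {n : ℕ} (A B : Finset (Fin n → Bool)) (D : ℝ)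
    (h : ∀ x ∈ A, ∀ y ∈ B, (hammingDist x y : ℝ) ≤ D) :
    (#A : ℝ) * #B ≤ (16 / 9) ^ n * 3 ^ D := by
  induction n generalizing D with
  | zero =>
    have hpos : (0 : ℝ) < 3 ^ D := by positivity
    rcases A.eq_empty_or_nonempty with rfl | ⟨x, hx⟩
    · simpa using hpos.le
    rcases B.eq_empty_or_nonempty with rfl | ⟨y, hy⟩
    · simpa using hpos.le
    have hD : 0 ≤ D := (Nat.cast_nonneg _).trans (h x hx y hy)
    have hA : (#A : ℝ) ≤ 1 := by exact_mod_cast card_le_one_of_subsingleton A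
    have hB : (#B : ℝ) ≤ 1 := by exact_mod_cast card_le_one_of_subsingleton B
    have h3 : (1 : ℝ) ≤ 3 ^ D := Real.one_le_rpow (by norm_num) hD
    have : (#A : ℝ) * #B ≤ 1 := mul_le_one₀ hA (Nat.cast_nonneg _) hB
    simpa using this.trans h3
  | succ n ih =>
    have same (b : Bool) :
        (#(cubeSection A b) : ℝ) * #(cubeSection B b) ≤ (16 / 9) ^ n * 3 ^ D := by
      refine ih _ _ _ fun x hx y hy => ?_
      simpa [hammingDist_cons] using
        h _ (mem_filter.1 hx).2 _ (mem_filter.1 hy).2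
    have diff (b : Bool) :
        (#(cubeSection A b) : ℝ) * #(cubeSection B !b) ≤ (16 / 9) ^ n * 3 ^ (D - 1) := by
      refine ih _ _ _ fun x hx y hy => ?_
      have := h _ (mem_filter.1 hx).2 _ (mem_filter.1 hy).2
      rw [hammingDist_cons] at this
      simp at this
      linarith
    rw [card_eq_card_cubeSection_add A, card_eq_card_cubeSection_add B]
    push_cast
    have e1 := same true
    have e2 := same false
    have e3 := diff true
    have e4 := diff false
    rw [Real.rpow_sub_one (by norm_num)] at e3 e4
    simp only [Bool.not_true, Bool.not_false] at e3 e4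
    rw [pow_succ]
    have hK : (0 : ℝ) < (16 / 9) ^ n * 3 ^ D := by positivity
    rw [← mul_div_assoc] at e3 e4
    rw [mul_right_comm]
    generalize (16 / 9 : ℝ) ^ n * 3 ^ D = K at *
    have n1 : (0 : ℝ) ≤ #(cubeSection A true) := Nat.cast_nonneg _
    have n2 : (0 : ℝ) ≤ #(cubeSection A false) := Nat.cast_nonneg _
    have n3 : (0 : ℝ) ≤ #(cubeSection B true) := Nat.cast_nonneg _
    have n4 : (0 : ℝ) ≤ #(cubeSection B false) := Nat.cast_nonneg _
    generalize (#(cubeSection A true) : ℝ) = a at *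
    generalize (#(cubeSection A false) : ℝ) = a' at *
    generalize (#(cubeSection B true) : ℝ) = b at *
    generalize (#(cubeSection B false) : ℝ) = b' at *
    have hprod : (a * b') * (a' * b) ≤ (K / 3) * (K / 3) :=
      mul_le_mul e3 e4 (by positivity) (by positivity)
    have hconv := mul_nonneg (sub_nonneg.2 e1) (sub_nonneg.2 e2)
    have hdiag : a * b + a' * b' ≤ 10 / 9 * K := by
      refine le_of_mul_le_mul_right ?_ hK
      nlinarith
    nlinarith

/-! ### Random signs -/

/-- The sign `±1` attached to a Boolean. -/
def boolSign (b : Bool) : ℝ := if b then 1 else -1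

lemma boolSign_not (b : Bool) : boolSign (!b) = -boolSign b := by
  cases b <;> simp [boolSign]

lemma boolSign_mul_self (b : Bool) : boolSign b * boolSign b = 1 := by
  cases b <;> simp [boolSign]

lemma sum_boolSign_mul_boolSign {ι : Type*} [Fintype ι] [DecidableEq ι] (i j : ι) :
    ∑ x : ι → Bool, boolSign (x i) * boolSign (x j) =
      if i = j then (2 : ℝ) ^ Fintype.card ι else 0 := by
  split_ifs with hij
  · subst hij
    simp [boolSign_mul_self]
  · let flip : (ι → Bool) → (ι → Bool) := fun x => Function.update x i (!(x i))
    have hflip : Function.Involutive flip := fun x => by simp [flip]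
    have h := Equiv.sum_comp (hflip.toPerm flip) fun x : ι → Bool => boolSign (x i) * boolSign (x j)
    have h' (x : ι → Bool) : boolSign (flip x i) * boolSign (flip x j) =
        -(boolSign (x i) * boolSign (x j)) := by
      simp [flip, Function.update_of_ne (Ne.symm hij), boolSign_not]
    simp only [Function.Involutive.coe_toPerm, h', sum_neg_distrib] at h
    linarith

lemma sum_sq_sum_boolSign_mul {ι : Type*} [Fintype ι] [DecidableEq ι] (a : ι → ℝ) :
    ∑ x : ι → Bool, (∑ i, boolSign (x i) * a i) ^ 2 = 2 ^ Fintype.card ι * ∑ i, a i ^ 2 := by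
  have h (x : ι → Bool) : (∑ i, boolSign (x i) * a i) ^ 2 =
      ∑ i, ∑ j, a i * a j * (boolSign (x i) * boolSign (x j)) := by
    rw [sq, sum_mul_sum]
    exact sum_congr rfl fun i _ => sum_congr rfl fun j _ => by ring
  simp_rw [h]
  rw [sum_comm]
  simp_rw [sum_comm (s := (univ : Finset (ι → Bool))), ← mul_sum, sum_boolSign_mul_boolSign]
  simp only [mul_ite, mul_zero, sum_ite_eq, mem_univ, if_true, mul_sum]
  exact sum_congr rfl fun i _ => by ring

/-- The squared norm of a signed sum of `d` vectors of the unit ball is at most `d` on average. -/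
lemma sum_sq_norm_signedSum_le {ι κ : Type*} [Fintype ι] [DecidableEq ι] [Fintype κ]
    (u : ι → κ → ℝ) (hu : ∀ j, ∑ i, u j i ^ 2 ≤ 1) :
    ∑ x : ι → Bool, ∑ k, (∑ i, boolSign (x i) * u i k) ^ 2 ≤
      2 ^ Fintype.card ι * Fintype.card ι := by
  rw [sum_comm]
  simp_rw [sum_sq_sum_boolSign_mul, ← mul_sum]
  rw [sum_comm]
  gcongr
  simpa using sum_le_sum fun j (_ : j ∈ univ) => hu j

/-- Jensen's inequality for `exp`, with the mean replaced by a lower bound `m`. -/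
lemma card_mul_exp_le_sum_exp {α : Type*} [Fintype α] (f : α → ℝ) (m : ℝ)
    (h : Fintype.card α * m ≤ ∑ x, f x) :
    Fintype.card α * Real.exp m ≤ ∑ x, Real.exp (f x) := by
  have h1 (x : α) : Real.exp m * (f x - m + 1) ≤ Real.exp (f x) := by
    have := mul_le_mul_of_nonneg_left (Real.add_one_le_exp (f x - m)) (Real.exp_pos m).le
    rwa [← Real.exp_add, add_sub_cancel] at this
  refine le_trans ?_ (sum_le_sum fun x _ => h1 x)
  rw [← mul_sum, sum_add_distrib, sum_sub_distrib]
  simp only [sum_const, card_univ, nsmul_eq_mul, mul_one]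
  nlinarith [Real.exp_pos m]

/-! ### Translates of symmetric sets under the Gaussian measure -/

lemma lintegral_fin_prod_eq_prod {n : ℕ} {E : Type*} [MeasurableSpace E]
    (μ : Fin n → Measure E) [∀ i, SigmaFinite (μ i)] (f : Fin n → E → ENNReal)
    (hf : ∀ i, Measurable (f i)) :
    ∫⁻ x, ∏ i, f i (x i) ∂(Measure.pi μ) = ∏ i, ∫⁻ x, f i x ∂(μ i) := by
  induction n with
  | zero => simp
  | succ n ih =>
    rw [← ((measurePreserving_piFinSuccAbove μ 0).symm).lintegral_comp (by fun_prop)]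
    simp only [MeasurableEquiv.piFinSuccAbove_symm_apply, Fin.insertNthEquiv,
      Fin.prod_univ_succ, Fin.insertNth_zero, Equiv.coe_fn_mk, Fin.cons_succ,
      Fin.zero_succAbove, cast_eq, Fin.cons_zero]
    rw [← ih (fun i => μ i.succ) (fun i => f i.succ) fun i => hf _,
      ← lintegral_prod_mul (hf 0).aemeasurable
        (Finset.measurable_fun_prod _ fun i _ =>
          (hf i.succ).comp (measurable_pi_apply i)).aemeasurable]

/-- The density of the standard Gaussian measure. -/
noncomputable def stdGaussianPDF (d : ℕ) (x : Fin d → ℝ) : ENNReal :=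
  ∏ i, gaussianPDF 0 1 (x i)

lemma measurable_stdGaussianPDF (d : ℕ) : Measurable (stdGaussianPDF d) := by
  have := measurable_gaussianPDF 0 1
  unfold stdGaussianPDF
  fun_prop

lemma stdGaussian_eq_withDensity (d : ℕ) :
    _root_.stdGaussian d = volume.withDensity (stdGaussianPDF d) := by
  refine Measure.pi_eq fun s hs => ?_
  rw [withDensity_apply _ (MeasurableSet.univ_pi hs), volume_pi, Measure.restrict_pi_pi]
  simp_rw [gaussianReal_apply 0 one_ne_zero]
  exact lintegral_fin_prod_eq_prod _ _ fun i => measurable_gaussianPDF 0 1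

lemma stdGaussianPDF_eq (d : ℕ) (x : Fin d → ℝ) :
    stdGaussianPDF d x =
      ENNReal.ofReal ((√(2 * Real.pi))⁻¹ ^ d * Real.exp (-(∑ i, x i ^ 2) / 2)) := by
  simp only [stdGaussianPDF, gaussianPDF]
  rw [← ENNReal.ofReal_prod_of_nonneg fun i _ => gaussianPDFReal_nonneg _ _ _]
  congr 1
  simp [gaussianPDFReal, prod_mul_distrib, ← Real.exp_sum, sum_div, neg_div]

lemma stdGaussianPDF_neg (d : ℕ) (x : Fin d → ℝ) :
    stdGaussianPDF d (-x) = stdGaussianPDF d x := by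
  simp [stdGaussianPDF_eq]

lemma exp_mul_stdGaussianPDF_le (d : ℕ) (x w : Fin d → ℝ) :
    2 * (ENNReal.ofReal (Real.exp (-(∑ i, w i ^ 2) / 2)) * stdGaussianPDF d x) ≤
      stdGaussianPDF d (x + w) + stdGaussianPDF d (x - w) := by
  have h2 : (2 : ENNReal) = ENNReal.ofReal 2 := by simp
  simp only [stdGaussianPDF_eq, h2]
  rw [← ENNReal.ofReal_add (by positivity) (by positivity),
    ← ENNReal.ofReal_mul (by positivity), ← ENNReal.ofReal_mul (by positivity)]
  refine ENNReal.ofReal_le_ofReal ?_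
  have hadd : -(∑ i, (x + w) i ^ 2) / 2 =
      (-(∑ i, w i ^ 2) / 2 + -(∑ i, x i ^ 2) / 2) + -∑ i, x i * w i := by
    simp only [Pi.add_apply, add_sq, sum_add_distrib, mul_assoc, ← mul_sum]
    ring
  have hsub : -(∑ i, (x - w) i ^ 2) / 2 =
      (-(∑ i, w i ^ 2) / 2 + -(∑ i, x i ^ 2) / 2) + ∑ i, x i * w i := by
    simp only [Pi.sub_apply, sub_sq, sum_add_distrib, sum_sub_distrib, mul_assoc, ← mul_sum]
    ring
  rw [hadd, hsub, Real.exp_add _ (-∑ i, x i * w i), Real.exp_add _ (∑ i, x i * w i), Real.exp_add]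
  have hcosh : 2 ≤ Real.exp (-∑ i, x i * w i) + Real.exp (∑ i, x i * w i) := by
    linarith [Real.add_one_le_exp (-∑ i, x i * w i), Real.add_one_le_exp (∑ i, x i * w i)]
  have hpos : 0 ≤ (√(2 * Real.pi))⁻¹ ^ d *
      (Real.exp (-(∑ i, w i ^ 2) / 2) * Real.exp (-(∑ i, x i ^ 2) / 2)) := by positivity
  linear_combination mul_le_mul_of_nonneg_left hcosh hpos

lemma stdGaussian_translate {d : ℕ} (V : Set (Fin d → ℝ)) (w : Fin d → ℝ) :
    _root_.stdGaussian d ((· - w) ⁻¹' V) = ∫⁻ x in V, stdGaussianPDF d (x + w) := by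
  rw [stdGaussian_eq_withDensity, withDensity_apply']
  have h := (measurePreserving_sub_right volume w).setLIntegral_comp_preimage_emb
    (MeasurableEquiv.subRight w).measurableEmbedding (fun x => stdGaussianPDF d (x + w)) V
  simpa using h

/-- Translating a symmetric set by `w` costs at most a factor `exp (-|w|² / 2)`. -/
lemma exp_mul_stdGaussian_le_translate {d : ℕ} {V : Set (Fin d → ℝ)}
    (hsymm : ∀ x ∈ V, -x ∈ V) (w : Fin d → ℝ) :
    ENNReal.ofReal (Real.exp (-(∑ i, w i ^ 2) / 2)) * _root_.stdGaussian d V ≤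
      _root_.stdGaussian d ((· - w) ⁻¹' V) := by
  have hneg : (Neg.neg ⁻¹' V : Set (Fin d → ℝ)) = V := by
    ext x
    exact ⟨fun h => by simpa using hsymm _ h, hsymm x⟩
  have hreflect : ∫⁻ x in V, stdGaussianPDF d (x - w) = ∫⁻ x in V, stdGaussianPDF d (x + w) := by
    have h := (Measure.measurePreserving_neg
      (volume : Measure (Fin d → ℝ))).setLIntegral_comp_preimage_emb
      (MeasurableEquiv.neg _).measurableEmbedding (fun x => stdGaussianPDF d (x + w)) V
    rw [hneg] at h
    rw [← h]
    refine lintegral_congr fun x => ?_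
    rw [← stdGaussianPDF_neg]
    congr 1
    abel
  have hm := measurable_stdGaussianPDF d
  have h2 : 2 * (ENNReal.ofReal (Real.exp (-(∑ i, w i ^ 2) / 2)) * _root_.stdGaussian d V) ≤
      2 * _root_.stdGaussian d ((· - w) ⁻¹' V) := by
    calc _ = ∫⁻ x in V, 2 * (ENNReal.ofReal (Real.exp (-(∑ i, w i ^ 2) / 2)) *
            stdGaussianPDF d x) := by
          rw [lintegral_const_mul _ (by fun_prop), lintegral_const_mul _ hm,
            stdGaussian_eq_withDensity, withDensity_apply']
      _ ≤ ∫⁻ x in V, (stdGaussianPDF d (x + w) + stdGaussianPDF d (x - w)) :=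
          lintegral_mono fun x => exp_mul_stdGaussianPDF_le d x w
      _ = _ := by
          rw [lintegral_add_left (by fun_prop), hreflect, stdGaussian_translate, two_mul]
  exact (ENNReal.mul_le_mul_iff_right (by simp) (by simp)).1 h2

/-- If every point lies in at most `N` of finitely many sets, then under a probability measure
their measures add up to at most `N`. -/
lemma sum_measure_le_of_card_le {α Ω : Type*} [Fintype α] [MeasurableSpace Ω] (μ : Measure Ω)
    [IsProbabilityMeasure μ] (S : α → Set Ω) (hS : ∀ x, NullMeasurableSet (S x) μ) (N : ENNReal)
    (h : ∀ (z : Ω) (A : Finset α), (∀ x ∈ A, z ∈ S x) → (#A : ENNReal) ≤ N) :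
    ∑ x, μ (S x) ≤ N := by
  classical
  calc ∑ x, μ (S x) = ∫⁻ z, ∑ x, (S x).indicator (fun _ => 1) z ∂μ := by
        rw [lintegral_finsetSum' _ fun x _ =>
          (aemeasurable_const (b := (1 : ENNReal))).indicator₀ (hS x)]
        exact sum_congr rfl fun x _ => (lintegral_indicator_one₀ (hS x)).symm
    _ ≤ ∫⁻ _, N ∂μ := lintegral_mono fun z => by
        refine le_trans (le_of_eq ?_) (h z {x | z ∈ S x} (by simp))
        simp [Set.indicator_apply]
    _ = N := by simp

/-! ### Vector balancing -/

lemma balancing_numeric_bound {d : ℕ} (hd : 0 < d) :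
    (4 / (3 : ℝ) ^ (3 / 4 : ℝ)) ^ d <
      2 ^ d * Real.exp (-(d : ℝ) / 32) * 2 ^ (-(d : ℝ) / 7) := by
  have key : Real.exp (1 / 32) * 2 ^ (8 / 7 : ℝ) < 3 ^ (3 / 4 : ℝ) := by
    refine lt_of_pow_lt_pow_left₀ 224 (by positivity) ?_
    rw [mul_pow, ← Real.exp_nat_mul, ← Real.rpow_mul_natCast (by norm_num),
      ← Real.rpow_mul_natCast (by norm_num)]
    norm_num
    have h7 : Real.exp 7 = Real.exp 1 ^ 7 := by rw [← Real.exp_nat_mul]; norm_num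
    have he : Real.exp 1 ^ 7 < 2.7182818286 ^ 7 :=
      pow_lt_pow_left₀ Real.exp_one_lt_d9 (Real.exp_pos 1).le (by norm_num)
    rw [h7]
    refine (mul_lt_mul_of_pos_right he (by positivity)).trans ?_
    norm_num
  have base : 4 / (3 : ℝ) ^ (3 / 4 : ℝ) < 2 * Real.exp (-1 / 32) * 2 ^ (-1 / 7 : ℝ) := by
    have e1 : Real.exp (-1 / 32) = (Real.exp (1 / 32))⁻¹ := by rw [← Real.exp_neg]; norm_num
    have e2 : (2 : ℝ) ^ (8 / 7 : ℝ) * 2 ^ (-1 / 7 : ℝ) = 2 := by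
      rw [← Real.rpow_add (by norm_num)]; norm_num
    have hp : (0 : ℝ) < 2 ^ (-1 / 7 : ℝ) := by positivity
    rw [e1, div_lt_iff₀ (by positivity), ← div_eq_mul_inv, div_mul_eq_mul_div, div_mul_eq_mul_div,
      lt_div_iff₀ (Real.exp_pos _)]
    have := mul_lt_mul_of_pos_left key hp
    linear_combination 2 * this - 2 * Real.exp (1 / 32) * e2
  have h := pow_lt_pow_left₀ base (by positivity) hd.ne'
  rw [mul_pow, mul_pow, ← Real.exp_nat_mul, ← Real.rpow_mul_natCast (by norm_num)] at h
  rwa [show (d : ℝ) * (-1 / 32) = -d / 32 by ring, show -1 / 7 * (d : ℝ) = -d / 7 by ring] at h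

/-- Giannopoulos' vector balancing result (special case). -/
theorem stmt10 (d : ℕ) (hd : 0 < d) (V : Set (Fin d → ℝ))
    (hconv : Convex ℝ V) (hsymm : ∀ x ∈ V, -x ∈ V)
    (hV : ENNReal.ofReal ((2 : ℝ) ^ (-(d : ℝ) / 7)) ≤ stdGaussian d V)
    (u : Fin d → (Fin d → ℝ)) (hu : ∀ j, ∑ i, (u j i) ^ 2 ≤ 1) :
    ∃ ε : Fin d → ℝ, (∀ i, ε i = -1 ∨ ε i = 0 ∨ ε i = 1) ∧
      (d : ℝ) / 2 ≤ ∑ i, |ε i| ∧ (∑ i, ε i • u i) ∈ (4 : ℝ) • V := by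
  by_contra hcon
  let w : (Fin d → Bool) → Fin d → ℝ := fun x => (1 / 4 : ℝ) • ∑ i, boolSign (x i) • u i
  have hclose (z : Fin d → ℝ) (x y : Fin d → Bool) (hx : z - w x ∈ V) (hy : z - w y ∈ V) :
      (hammingDist x y : ℝ) ≤ d / 2 := by
    by_contra! hfar
    refine hcon ⟨fun i => (boolSign (x i) - boolSign (y i)) / 2, fun i => ?_, ?_, ?_⟩
    · simp only [boolSign]
      cases x i <;> cases y i <;> norm_num
    · refine hfar.le.trans (le_of_eq ?_)
      simp only [hammingDist, card_filter, Nat.cast_sum]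
      refine sum_congr rfl fun i _ => ?_
      simp only [boolSign]
      cases x i <;> cases y i <;> norm_num
    · refine ⟨(1 / 2 : ℝ) • (z - w y) + (1 / 2 : ℝ) • (-(z - w x)),
        hconv hy (hsymm _ hx) (by norm_num) (by norm_num) (by norm_num), ?_⟩
      ext k
      simp only [w, Pi.smul_apply, Pi.add_apply, Pi.sub_apply, Pi.neg_apply, smul_eq_mul,
        Finset.sum_apply, sub_div, sub_mul, sum_sub_distrib, div_mul_eq_mul_div, ← sum_div]
      ring
  have hsmall (z : Fin d → ℝ) (A : Finset (Fin d → Bool)) (hA : ∀ x ∈ A, z ∈ (· - w x) ⁻¹' V) :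
      (#A : ENNReal) ≤ ENNReal.ofReal ((4 / (3 : ℝ) ^ (3 / 4 : ℝ)) ^ d) := by
    rw [← ENNReal.ofReal_natCast]
    refine ENNReal.ofReal_le_ofReal
      (pow_le_pow_iff_left₀ (by positivity) (by positivity) two_ne_zero |>.1 ?_)
    have h := card_mul_card_le_of_hammingDist_le A A (d / 2) fun x hx y hy =>
      hclose z x y (hA x hx) (hA y hy)
    have h3 : ((3 : ℝ) ^ (3 / 4 : ℝ)) ^ 2 * 3 ^ (1 / 2 : ℝ) = 9 := by
      rw [← Real.rpow_mul_natCast (by norm_num), ← Real.rpow_add (by norm_num)]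
      norm_num
    have hbase : (4 / (3 : ℝ) ^ (3 / 4 : ℝ)) ^ 2 = 16 / 9 * 3 ^ (1 / 2 : ℝ) := by
      rw [div_pow, div_eq_iff (by positivity)]
      linear_combination (-16 / 9) * h3
    rw [pow_right_comm, hbase, mul_pow, ← Real.rpow_mul_natCast (by norm_num), sq,
      one_div_mul_eq_div]
    exact h
  have hnull (x : Fin d → Bool) :
      NullMeasurableSet ((· - w x) ⁻¹' V) (_root_.stdGaussian d) := by
    have hc : Convex ℝ ((· - w x) ⁻¹' V) := by
      simpa [sub_eq_add_neg] using hconv.translate_preimage_left (-w x)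
    rw [stdGaussian_eq_withDensity]
    exact (hc.nullMeasurableSet volume).mono_ac (withDensity_absolutelyContinuous _ _)
  have : IsProbabilityMeasure (_root_.stdGaussian d) := by
    unfold _root_.stdGaussian
    infer_instance
  have hupper := sum_measure_le_of_card_le (_root_.stdGaussian d) _ hnull _ hsmall
  have hjensen : 2 ^ d * Real.exp (-(d : ℝ) / 32) ≤
      ∑ x, Real.exp (-(∑ k, w x k ^ 2) / 2) := by
    have h := card_mul_exp_le_sum_exp (fun x => -(∑ k, w x k ^ 2) / 2) (-(d : ℝ) / 32) ?_
    · simpa using h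
    have hnorm := sum_sq_norm_signedSum_le u hu
    have hw (x : Fin d → Bool) : -(∑ k, w x k ^ 2) / 2 =
        (-1 / 32) * ∑ k, (∑ i, boolSign (x i) * u i k) ^ 2 := by
      simp only [w, Pi.smul_apply, Finset.sum_apply, smul_eq_mul, mul_pow, ← mul_sum]
      ring
    simp only [hw, ← mul_sum]
    simp only [Fintype.card_fin, Fintype.card_pi, Fintype.card_bool, prod_const, card_univ]
      at hnorm ⊢
    push_cast
    linarith
  have hlower : ENNReal.ofReal (2 ^ d * Real.exp (-(d : ℝ) / 32) * 2 ^ (-(d : ℝ) / 7)) ≤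
      ∑ x, _root_.stdGaussian d ((· - w x) ⁻¹' V) := by
    calc _ ≤ ENNReal.ofReal (∑ x, Real.exp (-(∑ k, w x k ^ 2) / 2)) * _root_.stdGaussian d V := by
          rw [ENNReal.ofReal_mul (by positivity)]
          gcongr
      _ = ∑ x, ENNReal.ofReal (Real.exp (-(∑ k, w x k ^ 2) / 2)) * _root_.stdGaussian d V := by
          rw [ENNReal.ofReal_sum_of_nonneg fun _ _ => (Real.exp_pos _).le, sum_mul]
      _ ≤ _ := sum_le_sum fun x _ => exp_mul_stdGaussian_le_translate hsymm (w x)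
  have hle := (ENNReal.ofReal_le_ofReal_iff (by positivity)).1 (hlower.trans hupper)
  exact (balancing_numeric_bound hd).not_ge hle
end

section
/- (Gluskin-type corollary.) There is an absolute constant c > 0 such that for every q ∈ [1,2] and all positive integers m ≤ N with m | N, the generalized octahedron V_m^N = B_∞^N ∩ m·B₁^N satisfies d_{N/2}(V_m^N, ℓ_q^N) ≥ c·m^{1/q}. -/
open Finset

/-- Kolmogorov width with respect to the norm `nrm`. -/
noncomputable def kolWidth {V : Type*} [AddCommGroup V] [Module ℝ V] (k : ℕ)
    (M : Set V) (nrm : V → ℝ) : ℝ :=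
  ⨅ L : {L : Submodule ℝ V // Module.finrank ℝ L ≤ k},
    ⨆ x : M, ⨅ y : L.1, nrm (x.1 - y.1)

/-- The orthogonal complement of a subspace of codimension at least `N / 4` contains the projection
of a coordinate vector whose squared norm is at least `1 / 4`. -/
lemma exists_mem_orthogonal_large_coord {N : ℕ} (hN : 0 < N)
    (A : Submodule ℝ (EuclideanSpace ℝ (Fin N))) (hA : 4 * Module.finrank ℝ A ≤ 3 * N) :
    ∃ z ∈ Aᗮ, ∃ i, z i = ∑ j, z j ^ 2 ∧ 1 / 4 ≤ z i := by
  have hdim : Module.finrank ℝ A + Module.finrank ℝ Aᗮ = N := by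
    simpa using A.finrank_add_finrank_orthogonal
  let b := stdOrthonormalBasis ℝ Aᗮ
  have hnorm : ∀ k, ∑ i, ((b k : EuclideanSpace ℝ (Fin N)) i) ^ 2 = 1 := by
    intro k
    have h1 : ‖(b k : EuclideanSpace ℝ (Fin N))‖ = 1 := b.orthonormal.1 k
    rw [← EuclideanSpace.real_norm_sq_eq, h1, one_pow]
  have hsum : ∑ i, ∑ k, ((b k : EuclideanSpace ℝ (Fin N)) i) ^ 2
      = Module.finrank ℝ Aᗮ := by
    rw [Finset.sum_comm]
    simp [hnorm]
  obtain ⟨i, -, hi⟩ : ∃ i ∈ (univ : Finset (Fin N)),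
      (1 / 4 : ℝ) ≤ ∑ k, ((b k : EuclideanSpace ℝ (Fin N)) i) ^ 2 := by
    apply Finset.exists_le_of_sum_le ⟨⟨0, hN⟩, mem_univ _⟩
    rw [hsum]
    have h1 : (N : ℝ) ≤ 4 * Module.finrank ℝ Aᗮ := by
      exact_mod_cast (by omega : N ≤ 4 * Module.finrank ℝ Aᗮ)
    simp
    linarith
  let z : Aᗮ := ∑ k, ((b k : EuclideanSpace ℝ (Fin N)) i) • b k
  have hzi : (z : EuclideanSpace ℝ (Fin N)) i
      = ∑ k, ((b k : EuclideanSpace ℝ (Fin N)) i) ^ 2 := by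
    simp [z, sq]
  have hzn : ∑ j, ((z : EuclideanSpace ℝ (Fin N)) j) ^ 2
      = ∑ k, ((b k : EuclideanSpace ℝ (Fin N)) i) ^ 2 := by
    rw [← EuclideanSpace.real_norm_sq_eq, ← Submodule.coe_norm, ← real_inner_self_eq_norm_sq,
      b.orthonormal.inner_sum]
    simp [sq]
  exact ⟨z, z.2, i, by rw [hzi, hzn], by rw [hzi]; exact hi⟩

/-- Moving from a point of the cube along a nonzero direction until a new facet is hit. -/
lemma exists_step_to_facet {ι : Type*} [Fintype ι] (y z : ι → ℝ) (hy : ∀ i, |y i| ≤ 1)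
    {i : ι} (hz : z i ≠ 0) :
    ∃ t : ℝ, 0 ≤ t ∧ (∀ j, |y j + t * z j| ≤ 1) ∧ ∃ j, z j ≠ 0 ∧ |y j + t * z j| = 1 := by
  classical
  let T : ι → ℝ := fun j => (|z j| - z j * y j) / z j ^ 2
  obtain ⟨j, hj, hmin⟩ := Finset.exists_min_image (univ.filter fun j => z j ≠ 0) T
    ⟨i, by simpa using hz⟩
  have hzj : z j ≠ 0 := by simpa using hj
  have hT : 0 ≤ T j := by
    have h1 : z j * y j ≤ |z j| := calc
      z j * y j ≤ |z j * y j| := le_abs_self _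
      _ = |z j| * |y j| := abs_mul _ _
      _ ≤ |z j| * 1 := by gcongr; exact hy j
      _ = |z j| := mul_one _
    exact div_nonneg (by linarith) (sq_nonneg _)
  refine ⟨T j, hT, fun l => ?_, j, hzj, ?_⟩
  · by_cases hl : z l = 0
    · simpa [hl] using hy l
    · have h1 : T j ≤ T l := hmin l (by simpa using hl)
      have h2 : T j * z l ^ 2 ≤ |z l| - z l * y l :=
        (le_div_iff₀ (by positivity)).1 h1
      have h3 := abs_le.1 (hy l)
      rw [abs_le]
      rcases lt_or_gt_of_ne hl with h | h
      · rw [abs_of_neg h] at h2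
        constructor
        · by_contra! hc
          nlinarith
        · nlinarith [mul_nonneg hT (neg_nonneg.2 h.le)]
      · rw [abs_of_pos h] at h2
        constructor
        · nlinarith [mul_nonneg hT h.le]
        · by_contra! hc
          nlinarith
  · have h1 : y j + T j * z j = |z j| / z j := by
      simp only [T]
      field_simp
      ring
    rw [h1, abs_div, abs_abs, div_self (abs_ne_zero.2 hzj)]

/-- The orthogonal complement of a low-dimensional subspace contains a point of the cube with `k`
coordinates of modulus one and with small Euclidean norm. -/
lemma exists_mem_orthogonal_unit_coords {N : ℕ} (hN : 0 < N)
    (A : Submodule ℝ (EuclideanSpace ℝ (Fin N))) (k : ℕ)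
    (hA : 4 * Module.finrank ℝ A + 4 * k ≤ 3 * N + 4) :
    ∃ y ∈ Aᗮ, (∀ i, |y i| ≤ 1) ∧ ∑ i, y i ^ 2 ≤ 16 * k ∧
      ∃ F : Finset (Fin N), F.card = k ∧ ∀ i ∈ F, |y i| = 1 := by
  classical
  induction k with
  | zero => exact ⟨0, zero_mem _, by simp, by simp, ∅, by simp, by simp⟩
  | succ k ih =>
    obtain ⟨y, hyA, hy1, hy2, F, hFc, hF⟩ := ih (by omega)
    let B : Submodule ℝ (EuclideanSpace ℝ (Fin N)) :=
      Submodule.span ℝ (F.image fun j => EuclideanSpace.single j (1 : ℝ) : Finset _)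
    have hB : Module.finrank ℝ B ≤ k :=
      (finrank_span_finset_le_card _).trans (card_image_le.trans hFc.le)
    have hAB := Submodule.finrank_add_le_finrank_add_finrank A B
    obtain ⟨z, hz, i, hzi, hz4⟩ := exists_mem_orthogonal_large_coord hN (A ⊔ B) (by omega)
    have hzA : z ∈ Aᗮ := Submodule.orthogonal_le le_sup_left hz
    have hzF : ∀ j ∈ F, z j = 0 := by
      intro j hj
      have h1 : EuclideanSpace.single j (1 : ℝ) ∈ A ⊔ B :=
        Submodule.mem_sup_right (Submodule.subset_span (by
          simpa using ⟨j, hj, rfl⟩))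
      simpa [EuclideanSpace.inner_single_left] using (Submodule.mem_orthogonal _ _).1 hz _ h1
    obtain ⟨w, hwA, hwF, hwi, hwn, hwy⟩ : ∃ w ∈ Aᗮ, (∀ j ∈ F, w j = 0) ∧
        |w i| = ∑ j, w j ^ 2 ∧ 1 / 4 ≤ |w i| ∧ ∑ j, y j * w j ≤ 0 := by
      have hpos : |z i| = z i := abs_of_nonneg (by linarith)
      rcases le_total (∑ j, y j * z j) 0 with h | h
      · exact ⟨z, hzA, hzF, by rw [hpos, hzi], by rwa [hpos], h⟩
      · refine ⟨-z, neg_mem hzA, fun j hj => by simp [hzF j hj], ?_, ?_, ?_⟩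
        · simpa [hpos] using hzi
        · simpa [hpos] using hz4
        · simpa using h
    have hwi0 : w i ≠ 0 := abs_pos.1 (by linarith)
    obtain ⟨t, ht0, ht1, j, hwj, htj⟩ := exists_step_to_facet (fun l => y l) (fun l => w l) hy1 hwi0
    have hjF : j ∉ F := fun h => hwj (hwF j h)
    refine ⟨y + t • w, add_mem hyA (Submodule.smul_mem _ _ hwA), by simpa using ht1, ?_,
      insert j F, by rw [card_insert_of_notMem hjF, hFc], ?_⟩
    · have hexp : ∑ l, (y + t • w) l ^ 2
          = ∑ l, y l ^ 2 + 2 * t * ∑ l, y l * w l + t ^ 2 * ∑ l, w l ^ 2 := by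
        rw [Finset.mul_sum, Finset.mul_sum, ← Finset.sum_add_distrib, ← Finset.sum_add_distrib]
        refine Finset.sum_congr rfl fun l _ => ?_
        simp
        ring
      have htw : t * |w i| ≤ 2 := by
        have h1 : |t * w i| ≤ |y i + t * w i| + |y i| := by
          simpa using abs_sub (y i + t * w i) (y i)
        rw [abs_mul, abs_of_nonneg ht0] at h1
        linarith [ht1 i, hy1 i]
      have ht8 : t ≤ 8 := by nlinarith
      have hcross : 2 * t * ∑ l, y l * w l ≤ 0 := by nlinarith
      have hsq : t ^ 2 * |w i| ≤ 16 := by nlinarith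
      rw [hexp, ← hwi]
      push_cast
      linarith
    · intro l hl
      rcases Finset.mem_insert.1 hl with rfl | hl
      · simpa using htj
      · simpa [hwF l hl] using hF l hl

/-- Hölder's inequality against a vector of the cube, controlled by its Euclidean norm. -/
lemma sum_abs_mul_le_of_abs_le_one {ι : Type*} [Fintype ι] {q : ℝ} (hq1 : 1 ≤ q) (hq2 : q ≤ 2)
    (u y : ι → ℝ) (hy : ∀ i, |y i| ≤ 1) :
    ∑ i, |y i| * |u i| ≤ (∑ i, y i ^ 2) ^ (1 - 1 / q) * (∑ i, |u i| ^ q) ^ (1 / q) := by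
  have h := Real.inner_le_weight_mul_Lp_of_nonneg univ hq1 (fun i => y i ^ 2)
    (fun i => |u i| / |y i|) (fun i => sq_nonneg _) (fun i => by positivity)
  simp only [← one_div] at h
  have hl : ∀ i, y i ^ 2 * (|u i| / |y i|) = |y i| * |u i| := by
    intro i
    by_cases h0 : y i = 0
    · simp [h0]
    · have := abs_ne_zero.2 h0
      rw [← sq_abs]
      field_simp
  have hr : ∀ i, y i ^ 2 * (|u i| / |y i|) ^ q ≤ |u i| ^ q := by
    intro i
    by_cases h0 : y i = 0
    · simp only [h0]
      simpa using Real.rpow_nonneg (abs_nonneg (u i)) q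
    · have h1 := abs_pos.2 h0
      have h2 : y i ^ 2 ≤ |y i| ^ q := by
        rw [← sq_abs, ← Real.rpow_natCast]
        exact Real.rpow_le_rpow_of_exponent_ge h1 (hy i) (by simpa using hq2)
      rw [Real.div_rpow (abs_nonneg _) (abs_nonneg _), mul_div_assoc',
        div_le_iff₀ (Real.rpow_pos_of_pos h1 q), mul_comm]
      gcongr
  simp only [hl] at h
  refine h.trans ?_
  have h0 : ∀ i, 0 ≤ y i ^ 2 * (|u i| / |y i|) ^ q := fun i => by positivity
  have h1 : 0 ≤ ∑ i, y i ^ 2 * (|u i| / |y i|) ^ q := Finset.sum_nonneg fun i _ => h0 i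
  gcongr with i
  exact hr i

/-- A point of the generalized octahedron that is far from a given subspace in `ℓ_q`. -/
lemma exists_far_point {q : ℝ} (hq1 : 1 ≤ q) (hq2 : q ≤ 2) {m N : ℕ} (hm : 0 < m) (hmN : m ≤ N)
    (L : Submodule ℝ (Fin N → ℝ)) (hL : Module.finrank ℝ L ≤ N / 2) :
    ∃ x : Fin N → ℝ, ((∀ i, |x i| ≤ 1) ∧ ∑ i, |x i| ≤ m) ∧
      ∀ v ∈ L, 1 / 16 * (m : ℝ) ^ (1 / q) ≤ (∑ i, |(x - v) i| ^ q) ^ (1 / q) := by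
  classical
  let e := (WithLp.linearEquiv 2 ℝ (Fin N → ℝ)).symm
  let A : Submodule ℝ (EuclideanSpace ℝ (Fin N)) := L.map e.toLinearMap
  have hA : Module.finrank ℝ A ≤ N / 2 := (LinearEquiv.finrank_map_eq e L).le.trans hL
  obtain ⟨k, hk⟩ : ∃ k, k = (m + 3) / 4 := ⟨_, rfl⟩
  obtain ⟨y, hyA, hy1, hy2, F, hFc, hF⟩ :=
    exists_mem_orthogonal_unit_coords (by omega) A k (by omega)
  let x : Fin N → ℝ := fun i => if i ∈ F then y i else 0
  have hx : ∀ i, |x i| = if i ∈ F then 1 else 0 := by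
    intro i
    by_cases h : i ∈ F <;> simp [x, h, hF]
  have hxy : ∑ i, y i * x i = k := by
    have h1 : ∀ i, y i * x i = if i ∈ F then (1 : ℝ) else 0 := by
      intro i
      by_cases h : i ∈ F
      · simp only [x, h, if_true]
        rw [← abs_mul_abs_self, hF i h, one_mul]
      · simp [x, h]
    simp [h1, hFc]
  refine ⟨x, ⟨fun i => ?_, ?_⟩, fun v hv => ?_⟩
  · rw [hx]; split_ifs <;> norm_num
  · simp only [hx]
    simp only [sum_ite_mem, univ_inter, sum_const, hFc, nsmul_eq_mul, mul_one]
    exact_mod_cast (by omega : k ≤ m)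
  · have hyv : ∑ i, y i * v i = 0 := by
      have h1 := (Submodule.mem_orthogonal _ _).1 hyA (e v) (Submodule.mem_map_of_mem hv)
      simpa [PiLp.inner_apply, e] using h1
    have hk0 : (0 : ℝ) < k := by exact_mod_cast (by omega : 0 < k)
    have hkm : (m : ℝ) ≤ 4 * k := by exact_mod_cast (by omega : m ≤ 4 * k)
    have hq0 : 0 < q := by linarith
    have hle : (k : ℝ) ≤ ∑ i, |y i| * |(x - v) i| := calc
      (k : ℝ) = ∑ i, y i * (x - v) i := by
        simp only [Pi.sub_apply, mul_sub, sum_sub_distrib, hxy, hyv, sub_zero]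
      _ ≤ ∑ i, |y i| * |(x - v) i| :=
        Finset.sum_le_sum fun i _ => (le_abs_self _).trans (abs_mul _ _).le
    have hexp0 : 0 ≤ 1 - 1 / q := by
      rw [sub_nonneg, div_le_one hq0]; exact hq1
    have hexp1 : 1 - 1 / q ≤ 1 / 2 := by
      have : 1 / 2 ≤ 1 / q := one_div_le_one_div_of_le hq0 hq2
      linarith
    set D : ℝ := (∑ i, |(x - v) i| ^ q) ^ (1 / q) with hD
    have hD0 : 0 ≤ D := by positivity
    have hkD : (k : ℝ) ≤ 4 * (k : ℝ) ^ (1 - 1 / q) * D := calc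
      (k : ℝ) ≤ (∑ i, y i ^ 2) ^ (1 - 1 / q) * D :=
        hle.trans (sum_abs_mul_le_of_abs_le_one hq1 hq2 _ _ hy1)
      _ ≤ (16 * k : ℝ) ^ (1 - 1 / q) * D := by gcongr
      _ = (16 : ℝ) ^ (1 - 1 / q) * (k : ℝ) ^ (1 - 1 / q) * D := by
        rw [Real.mul_rpow (by norm_num) hk0.le]
      _ ≤ 4 * (k : ℝ) ^ (1 - 1 / q) * D := by
        gcongr
        calc (16 : ℝ) ^ (1 - 1 / q) ≤ 16 ^ (1 / 2 : ℝ) :=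
              Real.rpow_le_rpow_of_exponent_le (by norm_num) hexp1
          _ = 4 := by
              rw [← Real.sqrt_eq_rpow, show (16 : ℝ) = 4 ^ 2 by norm_num,
                Real.sqrt_sq (by norm_num)]
    have hkq : (k : ℝ) ^ (1 / q) ≤ 4 * D := by
      have hp : 0 < (k : ℝ) ^ (1 - 1 / q) := Real.rpow_pos_of_pos hk0 _
      have hs : (k : ℝ) ^ (1 - 1 / q) * (k : ℝ) ^ (1 / q) = k := by
        rw [← Real.rpow_add hk0]; simp
      refine le_of_mul_le_mul_left ?_ hp
      rw [hs]
      linarith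
    have hmk : (m : ℝ) ^ (1 / q) ≤ 4 * (k : ℝ) ^ (1 / q) := calc
      (m : ℝ) ^ (1 / q) ≤ (4 * k : ℝ) ^ (1 / q) := by gcongr
      _ = (4 : ℝ) ^ (1 / q) * (k : ℝ) ^ (1 / q) := Real.mul_rpow (by norm_num) hk0.le
      _ ≤ 4 * (k : ℝ) ^ (1 / q) := by
        gcongr
        calc (4 : ℝ) ^ (1 / q) ≤ 4 ^ (1 : ℝ) :=
              Real.rpow_le_rpow_of_exponent_le (by norm_num) (by linarith)
          _ = 4 := Real.rpow_one _
    linarith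

/-- Gluskin-type corollary: `d_{N/2}(V_m^N, ℓ_q^N) ≥ c m^{1/q}` for `q ∈ [1,2]`. -/
theorem stmt19 :
    ∃ c : ℝ, 0 < c ∧ ∀ q : ℝ, 1 ≤ q → q ≤ 2 →
      ∀ m N : ℕ, 0 < m → m ≤ N → m ∣ N →
        c * (m : ℝ) ^ (1 / q) ≤ kolWidth (N / 2)
          {x : Fin N → ℝ | (∀ i, |x i| ≤ 1) ∧ ∑ i, |x i| ≤ m}
          (fun x => (∑ i, |x i| ^ q) ^ (1 / q)) := by
  refine ⟨1 / 16, by norm_num, fun q hq1 hq2 m N hm hmN _ => ?_⟩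
  have hq0 : 0 < q := by linarith
  have : Nonempty {L : Submodule ℝ (Fin N → ℝ) // Module.finrank ℝ L ≤ N / 2} :=
    ⟨⟨⊥, by simp⟩⟩
  refine le_ciInf fun L => ?_
  obtain ⟨x, hx, hfar⟩ := exists_far_point hq1 hq2 hm hmN L.1 L.2
  have hbdd : BddAbove (Set.range fun x : {x : Fin N → ℝ | (∀ i, |x i| ≤ 1) ∧ ∑ i, |x i| ≤ m} =>
      ⨅ v : L.1, (∑ i, |(x.1 - v.1) i| ^ q) ^ (1 / q)) := by
    refine ⟨(N : ℝ) ^ (1 / q), ?_⟩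
    rintro _ ⟨w, rfl⟩
    have hbelow : BddBelow (Set.range fun v : L.1 => (∑ i, |(w.1 - v.1) i| ^ q) ^ (1 / q)) :=
      ⟨0, by rintro _ ⟨v, rfl⟩; positivity⟩
    refine (ciInf_le hbelow 0).trans ?_
    have hle : ∑ i, |(w.1 - (0 : L.1).1) i| ^ q ≤ N := calc
      ∑ i, |(w.1 - (0 : L.1).1) i| ^ q ≤ ∑ _i : Fin N, (1 : ℝ) :=
        Finset.sum_le_sum fun i _ =>
          Real.rpow_le_one (abs_nonneg _) (by simpa using w.2.1 i) hq0.le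
      _ = N := by simp
    gcongr
  exact (le_ciInf fun v : L.1 => hfar v.1 v.2).trans (le_ciSup hbdd ⟨x, hx⟩)
end
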